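/- arXiv:2603.01186 — 2 statements merged into one kernel-verified Lean document; each statement's English description precedes it below -/
import Mathlib

section
/- Consider the 7-dimensional ω = 0 OSN system with strictly positive parameters Λ, μ, μ_n, β, β_w, β₁, β₂, γ₁, γ₂, μ₁, μ₂, α₁, α₂, ε₁, ε₂. For every equilibrium point E* in the nonnegative orthant ℝ≥0^7 (i.e. every point of ℝ≥0^7 at which the vector field vanishes), the Jacobian matrix of the vector field at E* has no complex eigenvalue λ with Re(λ) = 0 and Im(λ) ≠ 0. In particular, the system cannot undergo a Hopf bifurcation at any nonnegative equilibrium for any positive parameter values. -/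
open Matrix Polynomial

noncomputable section

/-- The ω = 0 OSN rumor-spreading vector field on ℝ^7, in coordinates
`(x₁, U, W, S₁, B₁, S₂, B₂)` (indices 0,…,6). -/
def osnField (Λ μ μn β βw β₁ β₂ γ₁ γ₂ μ₁ μ₂ α₁ α₂ ε₁ ε₂ : ℝ)
    (p : Fin 7 → ℝ) : Fin 7 → ℝ :=
  ![Λ - μ * p 0 - β * p 0 * p 1,
    p 1 * (β * p 0 - μn - βw * p 2),
    βw * p 1 * p 2 - μ * p 2,
    β₁ * p 4 * p 1 / (ε₁ * p 4 + α₁ * p 1 + 1) - γ₁ * p 3,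
    γ₁ * p 3 - μ₁ * p 4,
    β₂ * p 6 * p 1 / (ε₂ * p 6 + α₂ * p 1 + 1) - γ₂ * p 5,
    γ₂ * p 5 - μ₂ * p 6]

/-- The Jacobian matrix of a vector field on ℝ^7, entry `(i, j)` being
`∂f_i/∂x_j` computed via the Fréchet derivative. -/
def jacobian7 (f : (Fin 7 → ℝ) → Fin 7 → ℝ) (x : Fin 7 → ℝ) :
    Matrix (Fin 7) (Fin 7) ℝ :=
  fun i j => fderiv ℝ (fun p => f p i) x (Pi.single j 1)

/-- `μ : ℂ` is an eigenvalue of the real matrix `A`, i.e. a complex root of its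
characteristic polynomial. -/
def Matrix.IsEigenvalueR {n : ℕ} (A : Matrix (Fin n) (Fin n) ℝ) (μ : ℂ) : Prop :=
  ((A.map (Complex.ofReal)).charpoly).IsRoot μ

/-- A real matrix is Hurwitz if every complex eigenvalue has strictly negative
real part. -/
def Matrix.IsHurwitz {n : ℕ} (A : Matrix (Fin n) (Fin n) ℝ) : Prop :=
  ∀ μ : ℂ, A.IsEigenvalueR μ → μ.re < 0


lemma osn_fd_quot (b g a e : ℝ) (i j k : Fin 7) (x : Fin 7 → ℝ)
    (h : e * x j + a * x i + 1 ≠ 0) :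
    ∃ c d : ℝ, ∀ v : Fin 7 → ℝ,
      fderiv ℝ (fun p : Fin 7 → ℝ => b * p j * p i / (e * p j + a * p i + 1) - g * p k) x v
        = c * v j + d * v i - g * v k := by
  have P : ∀ m : Fin 7, HasFDerivAt (fun p : Fin 7 → ℝ => p m)
      (ContinuousLinearMap.proj (R := ℝ) (φ := fun _ : Fin 7 => ℝ) m) x :=
    fun m => hasFDerivAt_apply m x
  have H := ((((P j).const_mul b).mul (P i)).mul ((hasDerivAt_inv h).comp_hasFDerivAt x ((((P j).const_mul e).add ((P i).const_mul a)).add_const 1))).sub ((P k).const_mul g)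
  have H2 := H.fderiv
  set D := e * x j + a * x i + 1 with hD
  refine ⟨(D * (b * x i) - b * x j * x i * e) / D ^ 2,
    (D * (b * x j) - b * x j * x i * a) / D ^ 2, fun v => ?_⟩
  refine (congrArg (fun L => L v) H2).trans ?_
  simp
  rw [← hD]
  field_simp
  ring

lemma osn_block (g m c w : ℝ) (hg : 0 < g) (hm : 0 < m) (hw : w ≠ 0) (s t : ℂ)
    (h1 : (w * Complex.I) * s = c * t - g * s) (h2 : (w * Complex.I) * t = g * s - m * t) :
    s = 0 ∧ t = 0 := by
  have hgc : (g : ℂ) ≠ 0 := by exact_mod_cast hg.ne'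
  have ht : t = 0 := by
    by_contra ht
    have : ((w * Complex.I + g) * (w * Complex.I + m) - g * c) * t = 0 := by
      linear_combination (w * Complex.I + g) * h2 + g * h1
    have h3 := (mul_eq_zero.mp this).resolve_right ht
    have h4 := congrArg Complex.im h3
    simp at h4
    have : w * (g + m) = 0 := by linarith
    rcases mul_eq_zero.mp this with h | h
    · exact hw h
    · linarith
  subst ht
  refine ⟨?_, rfl⟩
  simpa [hgc] using h2

lemma osn_real (a w : ℝ) (hw : w ≠ 0) (s : ℂ) (h : (w * Complex.I) * s = a * s) : s = 0 := by
  by_contra hs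
  have := mul_right_cancel₀ hs h
  have h4 := congrArg Complex.im this
  simp at h4
  exact hw h4

/-- Hopf impossibility for the ω = 0 OSN system: at every nonnegative equilibrium,
the Jacobian has no purely imaginary nonzero eigenvalue, so the system cannot undergo
a Hopf bifurcation there for any positive parameter values. -/
theorem osn_no_hopf
    (Λ μ μn β βw β₁ β₂ γ₁ γ₂ μ₁ μ₂ α₁ α₂ ε₁ ε₂ : ℝ)
    (hΛ : 0 < Λ) (hμ : 0 < μ) (hμn : 0 < μn) (hβ : 0 < β) (hβw : 0 < βw)
    (hβ₁ : 0 < β₁) (hβ₂ : 0 < β₂) (hγ₁ : 0 < γ₁) (hγ₂ : 0 < γ₂)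
    (hμ₁ : 0 < μ₁) (hμ₂ : 0 < μ₂) (hα₁ : 0 < α₁) (hα₂ : 0 < α₂)
    (hε₁ : 0 < ε₁) (hε₂ : 0 < ε₂)
    (E : Fin 7 → ℝ) (hE : ∀ i, 0 ≤ E i)
    (heq : ∀ i, osnField Λ μ μn β βw β₁ β₂ γ₁ γ₂ μ₁ μ₂ α₁ α₂ ε₁ ε₂ E i = 0) :
    ∀ lam : ℂ,
      (jacobian7 (osnField Λ μ μn β βw β₁ β₂ γ₁ γ₂ μ₁ μ₂ α₁ α₂ ε₁ ε₂) E).IsEigenvalueR lam →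
      lam.re = 0 → lam.im = 0 := by
  intro lam hl hre
  by_contra hw
  obtain ⟨w, rfl⟩ : ∃ w : ℝ, lam = w * Complex.I :=
    ⟨lam.im, by apply Complex.ext <;> simp [hre]⟩
  replace hw : w ≠ 0 := by simpa using hw
  have e0 := heq 0
  have e1 := heq 1
  have e2 := heq 2
  simp [osnField] at e0 e1 e2
  have x0 := hE 0
  have x1 := hE 1
  have x2 := hE 2
  have x4 := hE 4
  have x6 := hE 6
  have hx0 : 0 < E 0 := by
    rcases x0.lt_or_eq with h | h
    · exact h
    · rw [← h] at e0; simp at e0; exact absurd e0 hΛ.ne'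
  have P : ∀ m : Fin 7, HasFDerivAt (fun p : Fin 7 → ℝ => p m)
      (ContinuousLinearMap.proj (R := ℝ) (φ := fun _ : Fin 7 => ℝ) m) E :=
    fun m => hasFDerivAt_apply m E
  set F := osnField Λ μ μn β βw β₁ β₂ γ₁ γ₂ μ₁ μ₂ α₁ α₂ ε₁ ε₂ with hF
  have R0 : ∀ v, fderiv ℝ (fun p => F p 0) E v
      = (-μ - β * E 1) * v 0 + (- β * E 0) * v 1 := by
    intro v
    refine (congrArg (fun L => L v) ((((P 0).const_mul μ).const_sub Λ).sub
      (((P 0).const_mul β).mul (P 1))).fderiv).trans ?_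
    simp
    ring
  have R1 : ∀ v, fderiv ℝ (fun p => F p 1) E v
      = (β * E 1) * v 0 + (β * E 0 - μn - βw * E 2) * v 1 + (- βw * E 1) * v 2 := by
    intro v
    refine (congrArg (fun L => L v) ((P 1).mul ((((P 0).const_mul β).sub_const μn).sub
      ((P 2).const_mul βw))).fderiv).trans ?_
    simp
    ring
  have R2 : ∀ v, fderiv ℝ (fun p => F p 2) E v
      = (βw * E 2) * v 1 + (βw * E 1 - μ) * v 2 := by
    intro v
    refine (congrArg (fun L => L v) ((((P 1).const_mul βw).mul (P 2)).sub
      ((P 2).const_mul μ)).fderiv).trans ?_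
    simp
    ring
  obtain ⟨c1, d1, R3⟩ : ∃ c d : ℝ, ∀ v, fderiv ℝ (fun p => F p 3) E v
      = c * v 4 + d * v 1 - γ₁ * v 3 :=
    osn_fd_quot β₁ γ₁ α₁ ε₁ 1 4 3 E (by positivity)
  have R4 : ∀ v, fderiv ℝ (fun p => F p 4) E v = γ₁ * v 3 - μ₁ * v 4 := by
    intro v
    refine (congrArg (fun L => L v) (((P 3).const_mul γ₁).sub
      ((P 4).const_mul μ₁)).fderiv).trans ?_
    simp
  obtain ⟨c2, d2, R5⟩ : ∃ c d : ℝ, ∀ v, fderiv ℝ (fun p => F p 5) E v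
      = c * v 6 + d * v 1 - γ₂ * v 5 :=
    osn_fd_quot β₂ γ₂ α₂ ε₂ 1 6 5 E (by positivity)
  have R6 : ∀ v, fderiv ℝ (fun p => F p 6) E v = γ₂ * v 5 - μ₂ * v 6 := by
    intro v
    refine (congrArg (fun L => L v) (((P 5).const_mul γ₂).sub
      ((P 6).const_mul μ₂)).fderiv).trans ?_
    simp
  unfold Matrix.IsEigenvalueR at hl
  rw [Polynomial.IsRoot, Matrix.eval_charpoly] at hl
  obtain ⟨v, hv0, hv⟩ := Matrix.exists_mulVec_eq_zero_iff.mpr hl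
  have q : ∀ i, (w * Complex.I) * v i
      = ∑ j, ((fderiv ℝ (fun p => F p i) E (Pi.single j 1) : ℝ) : ℂ) * v j := by
    intro i
    have := congrFun hv i
    rw [Matrix.sub_mulVec] at this
    simp [Matrix.mulVec, dotProduct, jacobian7, Matrix.scalar_apply, Matrix.diagonal_apply] at this
    linear_combination this
  have q0 := q 0
  have q1 := q 1
  have q2 := q 2
  have q3 := q 3
  have q4 := q 4
  have q5 := q 5
  have q6 := q 6
  simp only [R0] at q0
  simp only [R1] at q1
  simp only [R2] at q2
  simp only [R3] at q3
  simp only [R4] at q4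
  simp only [R5] at q5
  simp only [R6] at q6
  simp [Fin.sum_univ_seven, Pi.single_apply] at q0 q1 q2 q3 q4 q5 q6
  have hv3 : v 0 = 0 ∧ v 1 = 0 ∧ v 2 = 0 := by
    have hβc : (β : ℂ) ≠ 0 := by exact_mod_cast hβ.ne'
    rcases e1 with h | h
    · rw [h] at q0 q1 q2
      have z1 : v 1 = 0 := by
        apply osn_real (β * E 0 - μn - βw * E 2) w hw
        push_cast
        simp only [Complex.ofReal_zero] at q1
        linear_combination q1
      rw [z1] at q0 q2
      refine ⟨osn_real (-μ) w hw _ ?_, z1, osn_real (-μ) w hw _ ?_⟩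
      · push_cast
        simp only [Complex.ofReal_zero] at q0
        linear_combination q0
      · push_cast
        simp only [Complex.ofReal_zero] at q2
        linear_combination q2
    have hc : (β : ℂ) * E 0 - μn - βw * E 2 = 0 := by exact_mod_cast h
    have hx0c : (E 0 : ℂ) ≠ 0 := by exact_mod_cast hx0.ne'
    have ha : 0 < μ + β * E 1 := by positivity
    by_cases hW : E 2 = 0
    · have z2 : v 2 = 0 := by
        apply osn_real (βw * E 1 - μ) w hw
        push_cast
        rw [hW] at q2
        simp only [Complex.ofReal_zero] at q2
        linear_combination q2
      rw [z2] at q1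
      have key : ((w * Complex.I) * (w * Complex.I + μ + β * E 1) + β * E 0 * (β * E 1)) * v 1
          = 0 := by
        linear_combination (w * Complex.I + μ + β * E 1) * q1 + β * E 1 * q0 +
          (w * Complex.I + μ + β * E 1) * v 1 * hc
      have z1 : v 1 = 0 := by
        refine (mul_eq_zero.mp key).resolve_left fun h3 => ?_
        have h4 := congrArg Complex.im h3
        simp at h4
        exact h4.elim hw ha.ne'
      refine ⟨osn_real (-μ - β * E 1) w hw _ ?_, z1, z2⟩
      push_cast
      rw [z1] at q0
      linear_combination q0
    · have hU : βw * E 1 - μ = 0 := by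
        have : (βw * E 1 - μ) * E 2 = 0 := by linarith
        exact (mul_eq_zero.mp this).resolve_right hW
      have hUc : (βw : ℂ) * E 1 - μ = 0 := by exact_mod_cast hU
      have hE1 : 0 < E 1 := by
        rcases x1.lt_or_eq with h | h
        · exact h
        · rw [← h] at hU; simp at hU; exact absurd hU hμ.ne'
      have hwc : (w : ℂ) * Complex.I ≠ 0 := by simp [hw]
      have key : (w * Complex.I + μ + β * E 1) * ((w * Complex.I) ^ 2 + βw * E 1 * (βw * E 2)) * v 1
          + (w * Complex.I) * (β * E 0 * (β * E 1)) * v 1 = 0 := by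
        linear_combination (w * Complex.I + μ + β * E 1) * (w * Complex.I) * q1
          + (w * Complex.I) * β * E 1 * q0 +
          (w * Complex.I + μ + β * E 1) * (w * Complex.I) * v 1 * hc
          - (w * Complex.I + μ + β * E 1) * βw * E 1 * (q2 + v 2 * hUc)
      have key2 : ((w * Complex.I + μ + β * E 1) * ((w * Complex.I) ^ 2 + βw * E 1 * (βw * E 2))
          + (w * Complex.I) * (β * E 0 * (β * E 1))) * v 1 = 0 := by
        linear_combination key
      have z1 : v 1 = 0 := by
        refine (mul_eq_zero.mp key2).resolve_left fun h3 => ?_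
        have h5 : (((μ + β * E 1) * (βw * E 1 * (βw * E 2) - w ^ 2) : ℝ) : ℂ)
            + ((w * (βw * E 1 * (βw * E 2) - w ^ 2) + w * (β * E 0 * (β * E 1)) : ℝ) : ℂ)
              * Complex.I = 0 := by
          push_cast
          linear_combination h3 - ((w : ℂ) ^ 2 * (w * Complex.I + μ + β * E 1)) * Complex.I_sq
        have h6 := congrArg Complex.re h5
        have h7 := congrArg Complex.im h5
        simp only [Complex.add_re, Complex.add_im, Complex.ofReal_re, Complex.ofReal_im,
          Complex.re_ofReal_mul, Complex.im_ofReal_mul, Complex.I_re, Complex.I_im,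
          Complex.zero_re, Complex.zero_im, mul_zero, mul_one, add_zero, zero_add] at h6 h7
        have h8 := (mul_eq_zero.mp h6).resolve_left ha.ne'
        rw [h8] at h7
        have : w * (β * E 0 * (β * E 1)) = 0 := by linarith
        exact (mul_ne_zero hw (by positivity)) this
      rw [z1] at q0 q2
      refine ⟨osn_real (-μ - β * E 1) w hw _ ?_, z1, osn_real (βw * E 1 - μ) w hw _ ?_⟩
      · push_cast
        linear_combination q0
      · push_cast
        linear_combination q2
  obtain ⟨hv_0, hv_1, hv_2⟩ := hv3
  rw [hv_1] at q3 q5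
  obtain ⟨hv_3, hv_4⟩ := osn_block γ₁ μ₁ c1 w hγ₁ hμ₁ hw (v 3) (v 4)
    (by linear_combination q3) (by linear_combination q4)
  obtain ⟨hv_5, hv_6⟩ := osn_block γ₂ μ₂ c2 w hγ₂ hμ₂ hw (v 5) (v 6)
    (by linear_combination q5) (by linear_combination q6)
  apply hv0
  ext i
  fin_cases i <;> assumption


end
end

section
/- Consider the 7-dimensional ω = 0 OSN system with strictly positive parameters, and suppose R₀ := βΛ/(μ μ_n) > 1 + β/β_w, so the rumor-free equilibrium RFE = (x̃₁, Ũ, W̃, 0, 0, 0, 0) with x̃₁ := Λβ_w/(μ(β + β_w)), Ũ := μ/β_w, W̃ := (β x̃₁ − μ_n)/β_w > 0 exists in the nonnegative orthant. Define R_j(U) := β_j U/(μ_j(1 + α_j U)) for j = 1, 2. Then the Jacobian of the vector field at RFE is Hurwitz (all complex eigenvalues have strictly negative real part) if and only if R₁(Ũ) < 1 and R₂(Ũ) < 1; if R_j(Ũ) > 1 for some j, the Jacobian at RFE has an eigenvalue with strictly positive real part. -/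
open Matrix Polynomial

noncomputable section

lemma osn_quad_hurwitz (b c : ℝ) (hb : 0 < b) (hc : 0 < c) (z : ℂ)
    (h : z ^ 2 + (b : ℂ) * z + (c : ℂ) = 0) : z.re < 0 := by
  have h1 := congrArg Complex.re h
  have h2 := congrArg Complex.im h
  simp [pow_succ] at h1 h2
  by_contra hp
  push Not at hp
  have h3 : z.im * (2 * z.re + b) = 0 := by linarith
  rcases mul_eq_zero.mp h3 with h4 | h4
  · rw [h4] at h1
    nlinarith [mul_nonneg hp hp, mul_nonneg hb.le hp]
  · linarith

lemma osn_cubic_hurwitz (a m n : ℝ) (ha : 0 < a) (hm : 0 < m) (hn : 0 < n) (z : ℂ)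
    (h : z ^ 3 + (a : ℂ) * z ^ 2 + ((m : ℂ) + n) * z + (a : ℂ) * m = 0) : z.re < 0 := by
  have h1 := congrArg Complex.re h
  have h2 := congrArg Complex.im h
  simp [pow_succ] at h1 h2
  by_contra hp
  push Not at hp
  set p := z.re
  set q := z.im
  have h3 : q * (3 * p ^ 2 - q ^ 2 + 2 * a * p + m + n) = 0 := by linarith
  rcases mul_eq_zero.mp h3 with h4 | h4
  · rw [h4] at h1
    have : 0 < p ^ 3 + a * p ^ 2 + (m + n) * p + a * m := by positivity
    linarith
  · have h5 : q ^ 2 = 3 * p ^ 2 + 2 * a * p + m + n := by linarith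
    have h6 : p ^ 3 - 3 * p * q ^ 2 + a * (p ^ 2 - q ^ 2) + (m + n) * p + a * m = 0 := by
      linarith
    rw [h5] at h6
    have : 0 < 8 * p ^ 3 + 8 * a * p ^ 2 + 2 * (m + n) * p + 2 * a ^ 2 * p + a * n := by
      positivity
    linarith

lemma osn_quad_root (b c : ℝ) (hb : 0 < b) (hc : c ≤ 0) :
    ∃ z : ℂ, z ^ 2 + (b : ℂ) * z + (c : ℂ) = 0 ∧ 0 ≤ z.re ∧ (c < 0 → 0 < z.re) := by
  have hd : 0 ≤ b ^ 2 - 4 * c := by nlinarith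
  refine ⟨(((-b + Real.sqrt (b ^ 2 - 4 * c)) / 2 : ℝ) : ℂ), ?_, ?_, ?_⟩
  · have := Real.sq_sqrt hd
    norm_cast
    nlinarith
  · rw [Complex.ofReal_re]
    have : b ≤ Real.sqrt (b ^ 2 - 4 * c) := Real.le_sqrt_of_sq_le (by linarith)
    linarith
  · intro hc'
    rw [Complex.ofReal_re]
    have : b < Real.sqrt (b ^ 2 - 4 * c) := Real.lt_sqrt_of_sq_lt (by linarith)
    linarith

lemma osn_eig (a b c d e g₁ k₁ m₁ g₂ k₂ m₂ : ℝ) (z : ℂ) :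
    (!![-a, -b, 0, 0, 0, 0, 0;
        c, 0, -d, 0, 0, 0, 0;
        0, e, 0, 0, 0, 0, 0;
        0, 0, 0, -g₁, k₁, 0, 0;
        0, 0, 0, g₁, -m₁, 0, 0;
        0, 0, 0, 0, 0, -g₂, k₂;
        0, 0, 0, 0, 0, g₂, -m₂] : Matrix (Fin 7) (Fin 7) ℝ).IsEigenvalueR z ↔
      z ^ 3 + (a : ℂ) * z ^ 2 + (((d * e : ℝ) : ℂ) + (b * c : ℝ)) * z + (a : ℂ) * (d * e : ℝ) = 0 ∨
      z ^ 2 + ((g₁ + m₁ : ℝ) : ℂ) * z + ((g₁ * (m₁ - k₁) : ℝ) : ℂ) = 0 ∨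
      z ^ 2 + ((g₂ + m₂ : ℝ) : ℂ) * z + ((g₂ * (m₂ - k₂) : ℝ) : ℂ) = 0 := by
  rw [← mul_eq_zero, ← mul_eq_zero]
  unfold Matrix.IsEigenvalueR
  rw [Polynomial.IsRoot.def, Matrix.eval_charpoly]
  apply Eq.congr_left
  have : (Matrix.scalar (Fin 7) z - Matrix.map (!![-a, -b, 0, 0, 0, 0, 0;
        c, 0, -d, 0, 0, 0, 0;
        0, e, 0, 0, 0, 0, 0;
        0, 0, 0, -g₁, k₁, 0, 0;
        0, 0, 0, g₁, -m₁, 0, 0;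
        0, 0, 0, 0, 0, -g₂, k₂;
        0, 0, 0, 0, 0, g₂, -m₂] : Matrix (Fin 7) (Fin 7) ℝ) Complex.ofReal)
      = !![z + a, (b:ℂ), 0, 0, 0, 0, 0;
        -(c:ℂ), z, d, 0, 0, 0, 0;
        0, -(e:ℂ), z, 0, 0, 0, 0;
        0, 0, 0, z + g₁, -k₁, 0, 0;
        0, 0, 0, -g₁, z + m₁, 0, 0;
        0, 0, 0, 0, 0, z + g₂, -k₂;
        0, 0, 0, 0, 0, -g₂, z + m₂] := by
    ext i j
    fin_cases i <;> fin_cases j <;> simp [Matrix.scalar_apply, Matrix.diagonal]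
  rw [this]
  have hb : (!![z + a, (b:ℂ), 0, 0, 0, 0, 0;
        -(c:ℂ), z, d, 0, 0, 0, 0;
        0, -(e:ℂ), z, 0, 0, 0, 0;
        0, 0, 0, z + g₁, -k₁, 0, 0;
        0, 0, 0, -g₁, z + m₁, 0, 0;
        0, 0, 0, 0, 0, z + g₂, -k₂;
        0, 0, 0, 0, 0, -g₂, z + m₂] : Matrix (Fin 7) (Fin 7) ℂ) =
      (Matrix.fromBlocks !![z + a, (b:ℂ), 0; -(c:ℂ), z, d; 0, -(e:ℂ), z] 0 0
        (!![z + g₁, -k₁, 0, 0; -g₁, z + m₁, 0, 0; 0, 0, z + g₂, -k₂; 0, 0, -g₂, z + m₂] :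
          Matrix (Fin 4) (Fin 4) ℂ)).submatrix
        (finSumFinEquiv (m := 3) (n := 4)).symm (finSumFinEquiv (m := 3) (n := 4)).symm := by
    ext i j
    fin_cases i <;> fin_cases j <;> rfl
  rw [hb, Matrix.det_submatrix_equiv_self, Matrix.det_fromBlocks_zero₁₂, Matrix.det_fin_three]
  congr 1
  · simp
    ring
  · simp [Matrix.det_succ_row_zero, Fin.sum_univ_succ, Fin.succAbove, Matrix.submatrix]
    ring

lemma osn_fderiv {f : (Fin 7 → ℝ) → ℝ} {x v : Fin 7 → ℝ} {d : ℝ}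
    (hf : DifferentiableAt ℝ f x) (h : HasDerivAt (fun t : ℝ => f (x + t • v)) d 0) :
    fderiv ℝ f x v = d := by
  rw [← hf.lineDeriv_eq_fderiv]
  exact h.deriv

lemma osn_jac (Λ μ μn β βw β₁ β₂ γ₁ γ₂ μ₁ μ₂ α₁ α₂ ε₁ ε₂ x U W : ℝ)
    (h1 : α₁ * U + 1 ≠ 0) (h2 : α₂ * U + 1 ≠ 0) (hU : βw * U = μ)
    (hW : β * x - μn - βw * W = 0) :
    jacobian7 (osnField Λ μ μn β βw β₁ β₂ γ₁ γ₂ μ₁ μ₂ α₁ α₂ ε₁ ε₂) ![x, U, W, 0, 0, 0, 0] =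
    !![-(μ + β * U), -(β * x), 0, 0, 0, 0, 0;
        β * U, 0, -(βw * U), 0, 0, 0, 0;
        0, βw * W, 0, 0, 0, 0, 0;
        0, 0, 0, -γ₁, β₁ * U / (α₁ * U + 1), 0, 0;
        0, 0, 0, γ₁, -μ₁, 0, 0;
        0, 0, 0, 0, 0, -γ₂, β₂ * U / (α₂ * U + 1);
        0, 0, 0, 0, 0, γ₂, -μ₂] := by
  have hp : ∀ i : Fin 7, HasFDerivAt (fun p : Fin 7 → ℝ => p i)
      (ContinuousLinearMap.proj (R := ℝ) (φ := fun _ : Fin 7 => ℝ) i)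
      (![x, U, W, 0, 0, 0, 0] : Fin 7 → ℝ) := fun i => hasFDerivAt_apply i _
  have hS : ∀ (i k : Fin 7) (b e a g : ℝ), (![x, U, W, 0, 0, 0, 0] : Fin 7 → ℝ) i = 0 →
      a * U + 1 ≠ 0 → 
      fderiv ℝ (fun p : Fin 7 → ℝ => b * p i * p 1 / (e * p i + a * p 1 + 1) - g * p k)
        ![x, U, W, 0, 0, 0, 0] = 
      (b * U / (a * U + 1)) • ContinuousLinearMap.proj (R := ℝ) (φ := fun _ : Fin 7 => ℝ) i
       - g • ContinuousLinearMap.proj (R := ℝ) (φ := fun _ : Fin 7 => ℝ) k := by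
    intro i k b e a g hi ha
    have hden : e * (![x, U, W, 0, 0, 0, 0] : Fin 7 → ℝ) i
      + a * (![x, U, W, 0, 0, 0, 0] : Fin 7 → ℝ) 1 + 1 ≠ 0 := by
      rw [hi]; simpa using ha
    have hq : HasFDerivAt (fun p : Fin 7 → ℝ => e * p i + a * p 1 + 1) _
        (![x, U, W, 0, 0, 0, 0] : Fin 7 → ℝ) :=
      (((hp i).const_mul e).add ((hp 1).const_mul a)).add_const 1
    have hinv := HasDerivAt.comp_hasFDerivAt
      (f := fun p : Fin 7 → ℝ => e * p i + a * p 1 + 1)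
      (![x, U, W, 0, 0, 0, 0] : Fin 7 → ℝ) (hasDerivAt_inv hden) hq
    have := ((((hp i).const_mul b).mul (hp 1)).mul hinv).sub ((hp k).const_mul g)
    simp only [div_eq_mul_inv (b * _ * _)]
    refine this.fderiv.trans ?_
    ext v
    simp [hi]
    field_simp
  ext i j
  unfold jacobian7 osnField
  fin_cases i
  · have := (((hp 0).const_mul μ).const_sub Λ).sub (((hp 0).const_mul β).mul (hp 1))
    refine (DFunLike.congr_fun this.fderiv _).trans ?_
    fin_cases j <;> simp [Pi.single_apply]
    ring
  · have := (hp 1).mul ((((hp 0).const_mul β).sub_const μn).sub ((hp 2).const_mul βw))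
    refine (DFunLike.congr_fun this.fderiv _).trans ?_
    fin_cases j <;> simp [Pi.single_apply] <;> linarith
  · have := (((hp 1).const_mul βw).mul (hp 2)).sub ((hp 2).const_mul μ)
    refine (DFunLike.congr_fun this.fderiv _).trans ?_
    fin_cases j <;> simp [Pi.single_apply] <;> linarith
  · refine (DFunLike.congr_fun (hS 4 3 β₁ ε₁ α₁ γ₁ (by simp) h1) _).trans ?_
    fin_cases j <;> simp [Pi.single_apply]
  · have := ((hp 3).const_mul γ₁).sub ((hp 4).const_mul μ₁)
    refine (DFunLike.congr_fun this.fderiv _).trans ?_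
    fin_cases j <;> simp [Pi.single_apply]
  · refine (DFunLike.congr_fun (hS 6 5 β₂ ε₂ α₂ γ₂ (by simp) h2) _).trans ?_
    fin_cases j <;> simp [Pi.single_apply]
  · have := ((hp 5).const_mul γ₂).sub ((hp 6).const_mul μ₂)
    refine (DFunLike.congr_fun this.fderiv _).trans ?_
    fin_cases j <;> simp [Pi.single_apply]

/-- Stability of the rumor-free equilibrium RFE of the ω = 0 OSN system (assuming it
exists, i.e. `R₀ > 1 + β/βw`): the Jacobian at RFE is Hurwitz iff the invasion numbers
of both rumors at RFE are below 1, i.e. `R₁(Ũ) < 1` and `R₂(Ũ) < 1` with `Ũ = μ/βw`;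
if `R_j(Ũ) > 1` for some `j`, the Jacobian at RFE has an eigenvalue with strictly
positive real part. -/
theorem osn_RFE_stability
    (Λ μ μn β βw β₁ β₂ γ₁ γ₂ μ₁ μ₂ α₁ α₂ ε₁ ε₂ : ℝ)
    (hΛ : 0 < Λ) (hμ : 0 < μ) (hμn : 0 < μn) (hβ : 0 < β) (hβw : 0 < βw)
    (hβ₁ : 0 < β₁) (hβ₂ : 0 < β₂) (hγ₁ : 0 < γ₁) (hγ₂ : 0 < γ₂)
    (hμ₁ : 0 < μ₁) (hμ₂ : 0 < μ₂) (hα₁ : 0 < α₁) (hα₂ : 0 < α₂)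
    (hε₁ : 0 < ε₁) (hε₂ : 0 < ε₂)
    (hR₀ : 1 + β / βw < β * Λ / (μ * μn)) :
    ((jacobian7 (osnField Λ μ μn β βw β₁ β₂ γ₁ γ₂ μ₁ μ₂ α₁ α₂ ε₁ ε₂)
        ![Λ * βw / (μ * (β + βw)), μ / βw,
          (β * (Λ * βw / (μ * (β + βw))) - μn) / βw, 0, 0, 0, 0]).IsHurwitz ↔
      (β₁ * (μ / βw) / (μ₁ * (1 + α₁ * (μ / βw))) < 1 ∧
       β₂ * (μ / βw) / (μ₂ * (1 + α₂ * (μ / βw))) < 1)) ∧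
    ((1 < β₁ * (μ / βw) / (μ₁ * (1 + α₁ * (μ / βw))) ∨
      1 < β₂ * (μ / βw) / (μ₂ * (1 + α₂ * (μ / βw)))) →
      ∃ lam : ℂ,
        (jacobian7 (osnField Λ μ μn β βw β₁ β₂ γ₁ γ₂ μ₁ μ₂ α₁ α₂ ε₁ ε₂)
          ![Λ * βw / (μ * (β + βw)), μ / βw,
            (β * (Λ * βw / (μ * (β + βw))) - μn) / βw, 0, 0, 0, 0]).IsEigenvalueR lam ∧
        0 < lam.re) := by
  set x := Λ * βw / (μ * (β + βw)) with hx
  have hxp : 0 < x := by positivity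
  set U := μ / βw with hUdef
  have hUp : 0 < U := by positivity
  set W := (β * x - μn) / βw with hWdef
  have hbx : μn < β * x := by
    have e1 : 1 + β / βw = (β + βw) / βw := by field_simp; ring
    rw [e1, div_lt_div_iff₀ hβw (by positivity)] at hR₀
    rw [hx, ← mul_div_assoc, lt_div_iff₀ (by positivity)]
    linarith
  have hWp : 0 < W := div_pos (by linarith) hβw
  have hU : βw * U = μ := by rw [hUdef]; field_simp
  have hW : β * x - μn - βw * W = 0 := by rw [hWdef]; field_simp; ring
  have hd1 : 0 < α₁ * U + 1 := by positivity
  have hd2 : 0 < α₂ * U + 1 := by positivity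
  rw [osn_jac Λ μ μn β βw β₁ β₂ γ₁ γ₂ μ₁ μ₂ α₁ α₂ ε₁ ε₂ x U W hd1.ne' hd2.ne' hU hW]
  have key : ∀ b m a : ℝ, 0 < m → 0 < a * U + 1 →
      (b * U / (m * (1 + a * U)) < 1 ↔ b * U / (a * U + 1) < m) ∧
      (1 < b * U / (m * (1 + a * U)) ↔ m < b * U / (a * U + 1)) := by
    intro b m a hm ha
    have e : b * U / (m * (1 + a * U)) = (b * U / (a * U + 1)) / m := by
      rw [div_div, add_comm 1, mul_comm m]
    rw [e, div_lt_one hm, one_lt_div hm]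
    exact ⟨Iff.rfl, Iff.rfl⟩
  rw [(key β₁ μ₁ α₁ hμ₁ hd1).1, (key β₁ μ₁ α₁ hμ₁ hd1).2,
    (key β₂ μ₂ α₂ hμ₂ hd2).1, (key β₂ μ₂ α₂ hμ₂ hd2).2]
  unfold Matrix.IsHurwitz
  simp only [osn_eig]
  generalize β₁ * U / (α₁ * U + 1) = k₁
  generalize β₂ * U / (α₂ * U + 1) = k₂
  refine ⟨⟨fun h => ⟨?_, ?_⟩, ?_⟩, ?_⟩
  · by_contra hk
    obtain ⟨z, hz, hz0, -⟩ := osn_quad_root (γ₁ + μ₁) (γ₁ * (μ₁ - k₁)) (by positivity)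
      (mul_nonpos_of_nonneg_of_nonpos hγ₁.le (by linarith))
    have := h z (Or.inr (Or.inl hz))
    linarith
  · by_contra hk
    obtain ⟨z, hz, hz0, -⟩ := osn_quad_root (γ₂ + μ₂) (γ₂ * (μ₂ - k₂)) (by positivity)
      (mul_nonpos_of_nonneg_of_nonpos hγ₂.le (by linarith))
    have := h z (Or.inr (Or.inr hz))
    linarith
  · rintro ⟨h1, h2⟩ z (hz | hz | hz)
    · exact osn_cubic_hurwitz _ _ _ (by positivity) (by positivity) (by positivity) z hz
    · exact osn_quad_hurwitz _ _ (by positivity) (mul_pos hγ₁ (by linarith)) z hz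
    · exact osn_quad_hurwitz _ _ (by positivity) (mul_pos hγ₂ (by linarith)) z hz
  · rintro (h | h)
    · have hc := mul_neg_of_pos_of_neg hγ₁ (by linarith : μ₁ - k₁ < 0)
      obtain ⟨z, hz, -, hz0⟩ := osn_quad_root (γ₁ + μ₁) (γ₁ * (μ₁ - k₁)) (by positivity) hc.le
      exact ⟨z, Or.inr (Or.inl hz), hz0 hc⟩
    · have hc := mul_neg_of_pos_of_neg hγ₂ (by linarith : μ₂ - k₂ < 0)
      obtain ⟨z, hz, -, hz0⟩ := osn_quad_root (γ₂ + μ₂) (γ₂ * (μ₂ - k₂)) (by positivity) hc.le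
      exact ⟨z, Or.inr (Or.inr hz), hz0 hc⟩


end
end
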